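/- arXiv:1004.4293 — 3 statements merged into one kernel-verified Lean document; each statement's English description precedes it below -/
import Mathlib

section
/- For n ≥ q+1, there is a bijection between q-admissible colorings of a cycle of length n−1 and q-admissible colorings of a cycle of length n that have at least two black beads and at least one black bead among positions 1,2,...,q. -/
/-- A coloring `c` of the cycle `ZMod n` (`true` = black) is `q`-admissible if
at least one bead is black and between any two cyclically consecutive black
beads the number of white beads is divisible by `q`.  The gap `d` from a black
bead to the next black bead has `d - 1` white beads strictly between. -/
def Admissible (q n : ℕ) (c : ZMod n → Bool) : Prop :=
  (∃ i, c i = true) ∧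
  ∀ i : ZMod n, c i = true → ∀ d : ℕ, 0 < d → c (i + (d : ZMod n)) = true →
    (∀ e : ℕ, 0 < e → e < d → c (i + (e : ZMod n)) = false) → q ∣ (d - 1)

/-- Blacks of `l` all lie at positions whose white-prefix-count equals `s` mod `q`. -/
def GG (q : ℕ) : ZMod q → List Bool → Prop
  | _, [] => True
  | s, true :: l => s = 0 ∧ GG q s l
  | s, false :: l => GG q (s - 1) l

lemma GG_rep (q : ℕ) (r : ℕ) : ∀ (s : ZMod q) (t : List Bool),
    GG q s (List.replicate r false ++ t) ↔ GG q (s - r) t := by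
  induction r with
  | zero => intro s t; simp
  | succ r ih =>
    intro s t
    rw [List.replicate_succ, List.cons_append]
    show GG q (s - 1) _ ↔ _
    rw [ih]
    have : s - 1 - (r : ZMod q) = s - ((r + 1 : ℕ) : ZMod q) := by push_cast; ring
    rw [this]

lemma GG_snoc (q : ℕ) (b : Bool) (l : List Bool) : ∀ (s : ZMod q),
    GG q s (l ++ [b]) ↔ GG q s l ∧ (b = true → s = (l.count false : ℕ)) := by
  induction l with
  | nil => intro s; cases b <;> simp [GG]
  | cons a l ih =>
    intro s
    cases a
    · show GG q (s - 1) (l ++ [b]) ↔ GG q (s - 1) l ∧ _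
      rw [ih]
      simp [sub_eq_iff_eq_add]
    · show s = 0 ∧ GG q s (l ++ [b]) ↔ (s = 0 ∧ GG q s l) ∧ _
      rw [ih]
      simp [and_assoc]

/-- white count -/
def ww (f : ℕ → Bool) (i : ℕ) : ℕ := ((List.range i).map f).count false

lemma ww_succ (f : ℕ → Bool) (i : ℕ) : ww f (i + 1) = ww f i + if f i = true then 0 else 1 := by
  unfold ww
  rw [List.range_succ, List.map_append, List.count_append]
  cases h : f i <;> simp [h]

lemma GG_range (q : ℕ) (s : ZMod q) (f : ℕ → Bool) (n : ℕ) :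
    GG q s ((List.range n).map f) ↔ ∀ i < n, f i = true → s = (ww f i : ℕ) := by
  induction n with
  | zero => simp [GG]
  | succ n ih =>
    rw [List.range_succ, List.map_append, List.map_singleton, GG_snoc, ih]
    constructor
    · rintro ⟨h1, h2⟩ i hi hf
      rcases Nat.lt_succ_iff_lt_or_eq.1 hi with h | rfl
      · exact h1 i h hf
      · exact h2 hf
    · intro h
      exact ⟨fun i hi => h i (by omega), fun hf => h n (by omega) hf⟩

lemma ww_add (f : ℕ → Bool) (n : ℕ) (hf : ∀ i, f (i + n) = f i) (i : ℕ) :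
    ww f (i + n) = ww f i + ww f n := by
  induction i with
  | zero => simp [ww]
  | succ i ih =>
    rw [show i + 1 + n = (i + n) + 1 by ring, ww_succ, ww_succ, ih, hf]; ring

lemma ww_white (f : ℕ → Bool) (i d : ℕ) (h : ∀ e, e < d → f (i + e) = false) :
    ww f (i + d) = ww f i + d := by
  induction d with
  | zero => rfl
  | succ d ih =>
    rw [← add_assoc, ww_succ, ih (fun e he => h e (by omega)), h d (by omega)]; simp; ring

/-- periodic unrolling -/
def un (n : ℕ) (c : ZMod n → Bool) (i : ℕ) : Bool := c ((i + 1 : ℕ) : ZMod n)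

lemma un_per (n : ℕ) (c : ZMod n → Bool) (i : ℕ) : un n c (i + n) = un n c i := by
  unfold un; congr 1; push_cast; simp

lemma un_surj (n : ℕ) (hn : 0 < n) (x : ZMod n) : ∃ i < n, ((i + 1 : ℕ) : ZMod n) = x := by
  have : NeZero n := ⟨by omega⟩
  refine ⟨(x - 1).val, ZMod.val_lt _, ?_⟩
  push_cast
  rw [ZMod.natCast_zmod_val]; ring

/-- list condition -/
def LA (q : ℕ) (l : List Bool) : Prop :=
  true ∈ l ∧ q ∣ l.count false ∧ ∃ r < q, GG q ((r : ℕ) : ZMod q) l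

lemma adm_pairs (q n : ℕ) (c : ZMod n → Bool) (h : Admissible q n c) (d : ℕ) :
    ∀ i, un n c i = true → un n c (i + d) = true →
      ((ww (un n c) (i + d) : ℕ) : ZMod q) = (ww (un n c) i : ℕ) := by
  induction d using Nat.strong_induction_on with
  | _ d ih =>
    intro i hi hd
    rcases Nat.eq_zero_or_pos d with rfl | hpos
    · rfl
    by_cases hw : ∃ e, 0 < e ∧ e < d ∧ un n c (i + e) = true
    · obtain ⟨e, he, hed, hb⟩ := hw
      have h1 := ih e hed i hi hb
      have h2 := ih (d - e) (by omega) (i + e) hb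
        (by rw [show i + e + (d - e) = i + d by omega]; exact hd)
      rw [show i + e + (d - e) = i + d by omega] at h2
      rw [h2, h1]
    · push Not at hw
      have key : ∀ e : ℕ, c (((i + 1 : ℕ) : ZMod n) + (e : ZMod n)) = un n c (i + e) := by
        intro e; unfold un; congr 1; push_cast; ring
      have hq := h.2 ((i + 1 : ℕ) : ZMod n) hi d hpos (by rw [key]; exact hd)
        (by intro e h0 h1; rw [key]; simpa using hw e h0 h1)
      have h3 : ww (un n c) (i + d) = ww (un n c) i + (d - 1) := by
        have := ww_white (un n c) (i + 1) (d - 1) (by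
          intro e he
          have := hw (e + 1) (by omega) (by omega)
          rw [show i + 1 + e = i + (e + 1) by ring]; simpa using this)
        rw [show i + 1 + (d - 1) = i + d by omega, ww_succ, hi] at this
        simpa using this
      rw [h3]
      rw [Nat.cast_add, (ZMod.natCast_eq_zero_iff (d - 1) q).2 hq, add_zero]

lemma adm_iff (q n : ℕ) (hq : 1 ≤ q) (hn : 0 < n) (c : ZMod n → Bool) :
    Admissible q n c ↔ LA q ((List.range n).map (un n c)) := by
  have : NeZero q := ⟨by omega⟩
  have hex : (∃ i, c i = true) ↔ true ∈ (List.range n).map (un n c) := by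
    simp only [List.mem_map, List.mem_range]
    constructor
    · rintro ⟨x, hx⟩
      obtain ⟨i, hi, rfl⟩ := un_surj n hn x
      exact ⟨i, hi, hx⟩
    · rintro ⟨i, hi, h⟩; exact ⟨_, h⟩
  constructor
  · intro h
    have h1 := hex.1 h.1
    refine ⟨h1, ?_⟩
    simp only [List.mem_map, List.mem_range] at h1
    obtain ⟨i, hi, hb⟩ := h1
    have h2 := adm_pairs q n c h n i hb (by rw [un_per]; exact hb)
    rw [ww_add _ n (un_per n c)] at h2
    refine ⟨?_, (ww (un n c) i : ZMod q).val, ZMod.val_lt _, ?_⟩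
    · rw [← ZMod.natCast_eq_zero_iff]
      push_cast at h2
      simpa [ww] using h2
    · rw [ZMod.natCast_zmod_val, GG_range]
      intro j hj hbj
      rcases le_total i j with hij | hij
      · obtain ⟨d, rfl⟩ := Nat.exists_eq_add_of_le hij
        exact (adm_pairs q n c h d i hb hbj).symm
      · obtain ⟨d, rfl⟩ := Nat.exists_eq_add_of_le hij
        exact (adm_pairs q n c h d j hbj hb)
  · rintro ⟨h1, h2, r, hr, h3⟩
    refine ⟨hex.2 h1, ?_⟩
    rw [GG_range] at h3
    have hW : ((ww (un n c) n : ℕ) : ZMod q) = 0 := (ZMod.natCast_eq_zero_iff _ _).2 h2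
    have all : ∀ i, un n c i = true → ((r : ℕ) : ZMod q) = (ww (un n c) i : ℕ) := by
      intro i
      induction i using Nat.strong_induction_on with
      | _ i ih =>
        intro hi
        by_cases hin : i < n
        · exact h3 i hin hi
        · obtain ⟨j, rfl⟩ := Nat.exists_eq_add_of_le (not_lt.1 hin)
          rw [add_comm n j] at hi ⊢
          rw [ww_add _ n (un_per n c)]
          rw [un_per] at hi
          push_cast
          rw [hW, add_zero]
          exact ih j (by omega) hi
    intro x hx d hd hxd hw
    obtain ⟨i, hi, rfl⟩ := un_surj n hn x
    have key : ∀ e : ℕ, c (((i + 1 : ℕ) : ZMod n) + (e : ZMod n)) = un n c (i + e) := by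
      intro e; unfold un; congr 1; push_cast; ring
    rw [key] at hxd
    have a1 := all i hx
    have a2 := all _ hxd
    have h3 : ww (un n c) (i + d) = ww (un n c) i + (d - 1) := by
      have := ww_white (un n c) (i + 1) (d - 1) (by
        intro e he
        have := hw (e + 1) (by omega) (by omega)
        rw [key] at this
        rw [show i + 1 + e = i + (e + 1) by ring]; exact this)
      rw [show i + 1 + (d - 1) = i + d by omega, ww_succ, show un n c i = true from hx] at this
      simpa using this
    rw [h3, a1] at a2
    push_cast at a2
    rw [← ZMod.natCast_eq_zero_iff]
    simpa using a2.symm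

/-- colorings as lists -/
noncomputable def EL (n : ℕ) (hn : 0 < n) : (ZMod n → Bool) ≃ {l : List Bool // l.length = n} :=
  Equiv.ofBijective (fun c => ⟨(List.range n).map (un n c), by simp⟩) (by
    have : NeZero n := ⟨by omega⟩
    constructor
    · intro c c' h
      have h' : (List.range n).map (un n c) = (List.range n).map (un n c') := congrArg Subtype.val h
      rw [List.map_inj_left] at h'
      funext x
      obtain ⟨i, hi, rfl⟩ := un_surj n hn x
      exact h' i (List.mem_range.2 hi)
    · rintro ⟨l, hl⟩
      refine ⟨fun x => l.getD (x - 1).val false, Subtype.ext ?_⟩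
      apply List.ext_getElem
      · simp [hl]
      · intro i h1 h2
        have : i < n := by simpa using h1
        have hv : (((i + 1 : ℕ) : ZMod n) - 1).val = i := by
          push_cast
          rw [add_sub_cancel_right, ZMod.val_natCast, Nat.mod_eq_of_lt this]
        simp only [List.getElem_map, List.getElem_range, un, hv]
        simp [h2])

/-- target list condition -/
def LB (q : ℕ) (l : List Bool) : Prop :=
  ∃ r < q, ∃ t, l = List.replicate r false ++ true :: t ∧ true ∈ t ∧ GG q 0 t ∧
    q ∣ r + t.count false

lemma LA_form (q : ℕ) (l : List Bool) (s r : ℕ) (hr : r + s < q) (hl : r ≤ l.length)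
    (h : GG q ((r : ℕ) : ZMod q) l) : ∃ t, l = List.replicate r false ++ t := by
  induction r generalizing l s with
  | zero => exact ⟨l, by simp⟩
  | succ r ih =>
    cases l with
    | nil => simp at hl
    | cons a l =>
      cases a
      · have h' : GG q (((r + 1 : ℕ) : ZMod q) - 1) l := h
        have e : ((r + 1 : ℕ) : ZMod q) - 1 = r := by push_cast; ring
        rw [e] at h'
        obtain ⟨t, rfl⟩ := ih l (s + 1) (by omega) (by simpa using hl) h'
        exact ⟨t, by simp [List.replicate_succ]⟩
      · have h0 := h.1
        rw [ZMod.natCast_eq_zero_iff] at h0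
        have := Nat.le_of_dvd (by omega) h0
        omega

lemma LA_iff (q : ℕ) (l : List Bool) (hl : q ≤ l.length) :
    LA q l ↔ ∃ r < q, ∃ t, l = List.replicate r false ++ t ∧ true ∈ t ∧ GG q 0 t ∧
      q ∣ r + t.count false := by
  constructor
  · rintro ⟨h1, h2, r, hr, h3⟩
    obtain ⟨t, rfl⟩ := LA_form q l 0 r (by omega) (by omega) h3
    rw [GG_rep] at h3
    refine ⟨r, hr, t, rfl, by simpa using h1, by simpa using h3, by simpa using h2⟩
  · rintro ⟨r, hr, t, rfl, h1, h2, h3⟩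
    refine ⟨by simp [h1], by simpa using h3, r, hr, ?_⟩
    rw [GG_rep]; simpa using h2

lemma GG_zero_unique (q : ℕ) (t : List Bool) : ∀ (s s' : ZMod q), true ∈ t → GG q s t → GG q s' t →
    s = s' := by
  induction t with
  | nil => simp
  | cons a t ih =>
    intro s s' hm h h'
    cases a
    · have := ih (s - 1) (s' - 1) (by simpa using hm) h h'
      exact sub_left_injective this
    · rw [h.1, h'.1]

lemma first_black (l : List Bool) (h : true ∈ l) :
    ∃ r t, l = List.replicate r false ++ true :: t := by
  induction l with
  | nil => simp at h
  | cons a l ih =>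
    cases a
    · obtain ⟨r, t, rfl⟩ := ih (by simpa using h)
      exact ⟨r + 1, t, by simp [List.replicate_succ]⟩
    · exact ⟨0, l, by simp⟩

lemma rep_inj (r r' : ℕ) (t t' : List Bool)
    (h : List.replicate r false ++ true :: t = List.replicate r' false ++ true :: t') :
    r = r' ∧ t = t' := by
  induction r generalizing r' with
  | zero =>
    cases r' with
    | zero => simpa using h
    | succ r' => simp [List.replicate_succ] at h
  | succ r ih =>
    cases r' with
    | zero => simp [List.replicate_succ] at h
    | succ r' =>
      simp only [List.replicate_succ, List.cons_append, List.cons.injEq, true_and] at h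
      have := ih r' h
      exact ⟨by omega, this.2⟩

lemma target_iff (q n : ℕ) (hq : 1 ≤ q) (hn : q + 1 ≤ n) (c : ZMod n → Bool) :
    (Admissible q n c ∧ (∃ i j : ZMod n, i ≠ j ∧ c i = true ∧ c j = true) ∧
          ∃ j : ℕ, 1 ≤ j ∧ j ≤ q ∧ c (j : ZMod n) = true) ↔
      LB q ((List.range n).map (un n c)) := by
  rw [adm_iff q n hq (by omega)]
  have hlen : ((List.range n).map (un n c)).length = n := by simp
  have hget : ∀ i, i < n → ((List.range n).map (un n c))[i]? = some (un n c i) := by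
    intro i hi; simp [hi]
  generalize hl : (List.range n).map (un n c) = l at *
  constructor
  · rintro ⟨⟨h1, h2, s, hs, h3⟩, ⟨x, y, hxy, hx, hy⟩, j, hj1, hjq, hj⟩
    obtain ⟨r, t, rfl⟩ := first_black l h1
    obtain ⟨j, rfl⟩ : ∃ k, j = k + 1 := ⟨j - 1, by omega⟩
    have hjb : un n c j = true := hj
    have hrj : r ≤ j := by
      by_contra hlt
      have := hget j (by omega)
      rw [List.getElem?_append_left (by simp; omega), hjb] at this
      simp [List.getElem?_replicate] at this
    refine ⟨r, by omega, t, rfl, ?_, ?_, by simpa using h2⟩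
    · obtain ⟨i, hi, hib, hir⟩ : ∃ i < n, un n c i = true ∧ i ≠ r := by
        obtain ⟨i, hi, rfl⟩ := un_surj n (by omega) x
        obtain ⟨k, hk, rfl⟩ := un_surj n (by omega) y
        by_cases hir : i = r
        · refine ⟨k, hk, hy, ?_⟩
          rintro rfl
          exact hxy (by rw [hir])
        · exact ⟨i, hi, hx, hir⟩
      have hg := hget i hi
      rw [hib] at hg
      have hri : r < i := by
        by_contra hlt
        rw [List.getElem?_append_left (by simp; omega)] at hg
        simp [List.getElem?_replicate] at hg
      rw [List.getElem?_append_right (by simp; omega)] at hg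
      obtain ⟨k, hk⟩ : ∃ k, i - r = k + 1 := ⟨i - r - 1, by omega⟩
      simp only [List.length_replicate, hk, List.getElem?_cons_succ] at hg
      exact List.mem_of_getElem? hg
    · rw [GG_rep] at h3
      have h4 := h3.2
      rwa [h3.1] at h4
  · rintro ⟨r, hr, t, rfl, h1, h2, h3⟩
    have hrb : un n c r = true := by
      have := hget r (by omega)
      simpa using this.symm
    refine ⟨⟨by simp, by simpa using h3, r, hr, ?_⟩, ?_, r + 1, by omega, by omega, hrb⟩
    · rw [GG_rep, sub_self]
      exact ⟨rfl, h2⟩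
    · obtain ⟨k, hk, hkt⟩ := List.mem_iff_getElem.1 h1
      have hlt : r + (k + 1) < n := by
        rw [← hlen]; simp; omega
      refine ⟨((r + 1 : ℕ) : ZMod n), ((r + (k + 1) + 1 : ℕ) : ZMod n), ?_, hrb, ?_⟩
      · intro he
        have he' : ((r : ℕ) : ZMod n) = ((r + (k + 1) : ℕ) : ZMod n) := by
          push_cast at he ⊢
          exact add_right_cancel he
        rw [ZMod.natCast_eq_natCast_iff', Nat.mod_eq_of_lt (by omega), Nat.mod_eq_of_lt hlt] at he'
        omega
      · have := hget _ hlt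
        rw [List.getElem?_append_right (by simp)] at this
        simp [hk, hkt] at this
        exact this

/-- list-level bijection -/
lemma list_bij (q m : ℕ) (hm : q ≤ m) :
    Nonempty ({l : {l : List Bool // l.length = m} // LA q l.1} ≃
      {l : {l : List Bool // l.length = m + 1} // LB q l.1}) := by
  have H : ∀ l : {l : {l : List Bool // l.length = m + 1} // LB q l.1},
      ∃ d : {l : {l : List Bool // l.length = m} // LA q l.1}, ∃ r < q, ∃ t,
        l.1.1 = List.replicate r false ++ true :: t ∧ d.1.1 = List.replicate r false ++ t ∧
        true ∈ t ∧ GG q 0 t := by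
    rintro ⟨⟨l, hl⟩, hB⟩
    obtain ⟨r, hr, t, e, h1, h2, h3⟩ := id hB
    change l = _ at e
    subst e
    have hl' : (List.replicate r false ++ t).length = m := by
      simp at hl ⊢; omega
    exact ⟨⟨⟨_, hl'⟩, (LA_iff q _ (by rw [hl']; exact hm)).2 ⟨r, hr, t, rfl, h1, h2, h3⟩⟩,
      r, hr, t, rfl, rfl, h1, h2⟩
  choose F hF using H
  refine ⟨(Equiv.ofBijective F ⟨?_, ?_⟩).symm⟩
  · intro l l' hll
    obtain ⟨r, hr, t, e1, e2, h1, h2⟩ := hF l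
    obtain ⟨r', hr', t', e1', e2', h1', h2'⟩ := hF l'
    rw [← hll, e2] at e2'
    have g1 : GG q ((r : ℕ) : ZMod q) (List.replicate r false ++ t) := by
      rw [GG_rep]; simpa using h2
    have g2 : GG q ((r' : ℕ) : ZMod q) (List.replicate r false ++ t) := by
      rw [e2', GG_rep]; simpa using h2'
    have hrr := GG_zero_unique q _ _ _ (by simp [h1]) g1 g2
    rw [ZMod.natCast_eq_natCast_iff', Nat.mod_eq_of_lt hr, Nat.mod_eq_of_lt hr'] at hrr
    subst hrr
    have ht := List.append_cancel_left e2'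
    subst ht
    exact Subtype.ext (Subtype.ext (e1.trans e1'.symm))
  · rintro ⟨⟨d, hd⟩, hA⟩
    obtain ⟨r, hr, t, rfl, h1, h2, h3⟩ := (LA_iff q d (by omega)).1 hA
    have hl' : (List.replicate r false ++ true :: t).length = m + 1 := by
      simp at hd ⊢; omega
    refine ⟨⟨⟨_, hl'⟩, r, hr, t, rfl, h1, h2, h3⟩, ?_⟩
    obtain ⟨r', hr', t', e1, e2, -, -⟩ := hF ⟨⟨_, hl'⟩, r, hr, t, rfl, h1, h2, h3⟩
    obtain ⟨rfl, rfl⟩ := rep_inj _ _ _ _ e1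
    exact Subtype.ext (Subtype.ext e2)

/-- Removing/inserting a black bead among positions `1,…,q` gives a bijection
between `q`-admissible colorings of length `n - 1` and those of length `n`
with at least two black beads and a black bead among positions `1,…,q`. -/
theorem stmt12 (q n : ℕ) (hq : 1 ≤ q) (hn : q + 1 ≤ n) :
    Nonempty
      ({c : ZMod (n - 1) → Bool // Admissible q (n - 1) c} ≃
        {c : ZMod n → Bool // Admissible q n c ∧
          (∃ i j : ZMod n, i ≠ j ∧ c i = true ∧ c j = true) ∧
          ∃ j : ℕ, 1 ≤ j ∧ j ≤ q ∧ c (j : ZMod n) = true}) := by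
  obtain ⟨m, rfl⟩ : ∃ m, n = m + 1 := ⟨n - 1, by omega⟩
  rw [Nat.add_sub_cancel]
  obtain ⟨e⟩ := list_bij q m (by omega)
  exact ⟨((EL m (by omega)).subtypeEquiv (fun c => adm_iff q m hq (by omega) c)).trans
    (e.trans ((EL (m + 1) (by omega)).subtypeEquiv (fun c => target_iff q (m + 1) hq hn c)).symm)⟩
end

section
/- The number of two-ball siteswap sequences of period n with a nonzero throw at every time step equals 2^n − 1. -/
/-- Distance from `i` to the next element of `S` (cyclically). -/
noncomputable def nextDist {n : ℕ} (S : Finset (ZMod n)) (i : ZMod n) : ℕ :=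
  sInf {k : ℕ | 1 ≤ k ∧ i + (k : ZMod n) ∈ S}

theorem nextDist_spec {n : ℕ} [NeZero n] (S : Finset (ZMod n)) {i : ZMod n} (hi : i ∈ S) :
    1 ≤ nextDist S i ∧ i + (nextDist S i : ZMod n) ∈ S := by
  have h : ({k : ℕ | 1 ≤ k ∧ i + (k : ZMod n) ∈ S}).Nonempty :=
    ⟨n, Nat.one_le_iff_ne_zero.mpr (NeZero.ne n), by simpa using hi⟩
  exact Nat.sInf_mem h

theorem nextDist_le {n : ℕ} (S : Finset (ZMod n)) {i : ZMod n} {k : ℕ} (hk : 1 ≤ k)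
    (h : i + (k : ZMod n) ∈ S) : nextDist S i ≤ k :=
  Nat.sInf_le ⟨hk, h⟩

theorem nextDist_aux {n : ℕ} (S : Finset (ZMod n)) {i j : ZMod n} {k l : ℕ}
    (hi : i ∈ S) (hkl : k ≤ l) (hl : l - k < nextDist S j)
    (h : i + (k : ZMod n) = j + (l : ZMod n)) : i = j ∧ k = l := by
  have hi' : i = j + ((l - k : ℕ) : ZMod n) := by
    rw [Nat.cast_sub hkl]
    linear_combination h
  have h0 : l - k = 0 := by
    by_contra hne
    have := nextDist_le S (i := j) (k := l - k) (by omega) (hi' ▸ hi)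
    omega
  rw [h0] at hi'
  exact ⟨by simpa using hi', by omega⟩

theorem sum_nextDist {n : ℕ} [NeZero n] (S : Finset (ZMod n)) (hS : S.Nonempty) :
    ∑ i ∈ S, nextDist S i = n := by
  have hc : (S.sigma (fun i => Finset.range (nextDist S i))).card
      = (Finset.univ : Finset (ZMod n)).card := by
    refine Finset.card_bij (fun p _ => p.1 + (p.2 : ZMod n)) (fun _ _ => Finset.mem_univ _) ?_ ?_
    · rintro ⟨i, k⟩ hik ⟨j, l⟩ hjl h
      simp only [Finset.mem_sigma, Finset.mem_range] at hik hjl h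
      rcases le_total k l with hkl | hkl
      · obtain ⟨rfl, rfl⟩ := nextDist_aux S hik.1 hkl (by omega) h
        rfl
      · obtain ⟨rfl, rfl⟩ := nextDist_aux S hjl.1 hkl (by omega) h.symm
        rfl
    · intro x _
      classical
      have hex : ∃ k : ℕ, x - (k : ZMod n) ∈ S := by
        obtain ⟨s, hs⟩ := hS
        exact ⟨(x - s).val, by simpa using hs⟩
      have hk := Nat.find_spec hex
      have hmin := fun m => Nat.find_min' hex (m := m)
      generalize Nat.find hex = k at hk hmin
      refine ⟨⟨x - (k : ZMod n), k⟩, ?_, by simp⟩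
      simp only [Finset.mem_sigma, Finset.mem_range]
      refine ⟨hk, ?_⟩
      by_contra hlt
      push Not at hlt
      obtain ⟨h1, h2⟩ := nextDist_spec S hk
      have := hmin (k - nextDist S (x - (k : ZMod n))) (by
        rw [Nat.cast_sub hlt]
        convert h2 using 1
        ring)
      omega
  simpa [ZMod.card] using hc

/-- There are `2 ^ n - 1` two-ball siteswaps of period `n` with a nonzero
throw at every time step. -/
theorem stmt15 (n : ℕ) [NeZero n] :
    Nat.card {t : ZMod n → ℕ // (∑ i, t i) = 2 * n ∧ (∀ i, 1 ≤ t i) ∧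
        Function.Bijective (fun i : ZMod n => i + (t i : ZMod n))} =
      2 ^ n - 1 := by
  classical
  have hn : 0 < n := Nat.pos_of_ne_zero (NeZero.ne n)
  -- the canonical form of a siteswap
  have key : ∀ t : ZMod n → ℕ, (∑ i, t i) = 2 * n → (∀ i, 1 ≤ t i) →
      Function.Bijective (fun i : ZMod n => i + (t i : ZMod n)) →
      (Finset.univ.filter (fun i => 1 < t i)).Nonempty ∧
      ∀ i, t i = if i ∈ Finset.univ.filter (fun i => 1 < t i) then
        nextDist (Finset.univ.filter (fun i => 1 < t i)) i + 1 else 1 := by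
    intro t hsum hpos hbij
    have hmem : ∀ i, i ∈ Finset.univ.filter (fun i => 1 < t i) ↔ 1 < t i := by simp
    generalize Finset.univ.filter (fun i => 1 < t i) = S at hmem
    have hoff : ∀ i, i ∉ S → t i = 1 := fun i hi => by
      have := hpos i
      rw [hmem] at hi
      omega
    have hsum1 : ∑ i, (t i - 1) = n := by
      have h : ∑ i, (t i - 1) + ∑ i : ZMod n, 1 = ∑ i, t i := by
        rw [← Finset.sum_add_distrib]
        exact Finset.sum_congr rfl fun i _ => Nat.sub_add_cancel (hpos i)
      simp only [Finset.sum_const, Finset.card_univ, ZMod.card, smul_eq_mul] at h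
      omega
    have hsumS : ∑ i ∈ S, (t i - 1) = n := by
      refine Eq.trans ?_ hsum1
      refine Finset.sum_subset (Finset.subset_univ _) fun i _ hi => ?_
      simp [hoff i hi]
    have hne : S.Nonempty := by
      rw [Finset.nonempty_iff_ne_empty]
      rintro rfl
      simp at hsumS
      omega
    have hle : ∀ i ∈ S, nextDist S i ≤ t i - 1 := by
      intro i hi
      have h1 := (hmem i).1 hi
      refine nextDist_le S (by omega) ?_
      by_contra hnot
      have h2 := hoff _ hnot
      have h3 : i + ((t i - 1 : ℕ) : ZMod n) = i := by
        apply hbij.1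
        simp only
        rw [h2, Nat.cast_sub (hpos i)]
        push_cast
        ring
      rw [h3] at hnot
      exact hnot hi
    have heq := (Finset.sum_eq_sum_iff_of_le hle).1 ((sum_nextDist S hne).trans hsumS.symm)
    refine ⟨hne, fun i => ?_⟩
    split_ifs with hi
    · have := heq i hi
      have := hpos i
      omega
    · exact hoff i hi
  have hcard : Nat.card {S : Finset (ZMod n) // S ≠ ∅} = 2 ^ n - 1 := by
    rw [Nat.card_eq_fintype_card, Fintype.card_subtype_compl]
    simp [ZMod.card]
  rw [← hcard]
  refine Nat.card_eq_of_bijective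
    (fun t => ⟨Finset.univ.filter (fun i => 1 < t.1 i),
      Finset.nonempty_iff_ne_empty.1 (key t.1 t.2.1 t.2.2.1 t.2.2.2).1⟩) ⟨?_, ?_⟩
  · rintro ⟨t, ht⟩ ⟨u, hu⟩ h
    simp only [Subtype.mk.injEq] at h
    apply Subtype.ext
    funext i
    have h1 := (key t ht.1 ht.2.1 ht.2.2).2 i
    have h2 := (key u hu.1 hu.2.1 hu.2.2).2 i
    rw [h] at h1
    exact h1.trans h2.symm
  · rintro ⟨S, hS⟩
    refine ⟨⟨fun i => if i ∈ S then nextDist S i + 1 else 1, ?_, ?_, ?_⟩, ?_⟩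
    · have h : ∀ i, (if i ∈ S then nextDist S i + 1 else 1)
          = (if i ∈ S then nextDist S i else 0) + 1 := by
        intro i
        split_ifs <;> rfl
      simp only [h, Finset.sum_add_distrib]
      rw [Finset.sum_ite_mem, Finset.univ_inter,
        sum_nextDist S (Finset.nonempty_iff_ne_empty.2 hS)]
      simp [ZMod.card]
      omega
    · intro i
      dsimp only
      split_ifs <;> omega
    · apply Finite.injective_iff_bijective.1
      intro i j h
      simp only at h
      split_ifs at h with hi hj hj
      · push_cast at h
        have h' : i + (nextDist S i : ZMod n) = j + (nextDist S j : ZMod n) := by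
          linear_combination h
        have hi1 := (nextDist_spec S hi).1
        have hj1 := (nextDist_spec S hj).1
        rcases le_total (nextDist S i) (nextDist S j) with hl | hl
        · exact (nextDist_aux S hi hl (by omega) h').1
        · exact (nextDist_aux S hj hl (by omega) h'.symm).1.symm
      · push_cast at h
        have h' : i + (nextDist S i : ZMod n) = j := by linear_combination h
        exact absurd (h' ▸ (nextDist_spec S hi).2) hj
      · push_cast at h
        have h' : j + (nextDist S j : ZMod n) = i := by linear_combination -h
        exact absurd (h' ▸ (nextDist_spec S hj).2) hi
      · simpa using h
    · apply Subtype.ext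
      ext i
      simp only [Finset.mem_filter, Finset.mem_univ, true_and]
      by_cases hi : i ∈ S
      · have := (nextDist_spec S hi).1
        simp [hi]
        omega
      · simp [hi]
end

section
/- Let (t_1,...,t_n) be a one-ball siteswap of period n with associated black/white necklace (black at i iff t_i > 0). The shifted sequence (t_1+1, ..., t_n+1) is a valid two-ball spherical siteswap (i.e., both i + t_i' mod n are distinct and, among indices with t_i' ≠ 0, the values 2i + t_i' mod 2n are distinct) if and only if between any two cyclically consecutive black beads of the necklace the number of white beads is even. -/
/-- In a one-ball siteswap, the arcs `[i, i + t i)` tile the circle; in particular they are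
pairwise disjoint. -/
theorem arcs_disjoint (n : ℕ) [NeZero n] (t : ZMod n → ℕ)
    (hsum : (∑ i, t i) = n)
    (hblack : ∀ i, 0 < t i → 0 < t (i + (t i : ZMod n))) :
    ∀ i j : ZMod n, ∀ a b : ℕ, a < t i → b < t j →
      i + (a : ZMod n) = j + (b : ZMod n) → i = j ∧ a = b := by
  have hn : 0 < n := Nat.pos_of_ne_zero (NeZero.ne n)
  let F : (Σ i : ZMod n, Fin (t i)) → ZMod n := fun p => p.1 + ((p.2 : ℕ) : ZMod n)
  have hsurj : Function.Surjective F := by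
    intro j
    have hex : ∃ i, 0 < t i := by
      by_contra h
      push Not at h
      have h0 : (∑ i, t i) = 0 := Finset.sum_eq_zero fun i _ => by
        have := h i
        omega
      omega
    have hex2 : ∃ e : ℕ, 0 < t (j - (e : ZMod n)) := by
      obtain ⟨i, hi⟩ := hex
      refine ⟨(j - i).val, ?_⟩
      rw [ZMod.natCast_zmod_val]
      simpa using hi
    classical
    let e := Nat.find hex2
    have he : 0 < t (j - (e : ZMod n)) := Nat.find_spec hex2
    have hmin : ∀ m, m < e → ¬ 0 < t (j - (m : ZMod n)) := fun m hm => Nat.find_min hex2 hm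
    have hlt : e < t (j - (e : ZMod n)) := by
      by_contra hle
      push Not at hle
      have hb := hblack _ he
      apply hmin (e - t (j - (e : ZMod n))) (by omega)
      rw [Nat.cast_sub hle]
      convert hb using 2
      ring
    exact ⟨⟨j - (e : ZMod n), ⟨e, hlt⟩⟩, by simp [F]⟩
  have hcard : Fintype.card (Σ i : ZMod n, Fin (t i)) = Fintype.card (ZMod n) := by
    simp [Fintype.card_sigma, ZMod.card, hsum]
  have hinj : Function.Injective F :=
    ((Fintype.bijective_iff_surjective_and_card F).2 ⟨hsurj, hcard⟩).1
  intro i j a b ha hb hab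
  have h := @hinj ⟨i, ⟨a, ha⟩⟩ ⟨j, ⟨b, hb⟩⟩ hab
  have h1 : i = j := congrArg Sigma.fst h
  subst h1
  simpa using h

/-- Shifting a one-ball siteswap by one gives a valid two-ball spherical
siteswap iff between any two cyclically consecutive black beads the number of
white beads is even. -/
theorem stmt16 (n : ℕ) [NeZero n] (t : ZMod n → ℕ)
    (hsum : (∑ i, t i) = n)
    (hvalid : Function.Bijective (fun i : ZMod n => i + (t i : ZMod n))) :
    (Function.Bijective (fun i : ZMod n => i + ((t i + 1 : ℕ) : ZMod n)) ∧
      ∀ i j : ZMod n, t i + 1 ≠ 0 → t j + 1 ≠ 0 →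
        (2 * i.val + (t i + 1)) % (2 * n) = (2 * j.val + (t j + 1)) % (2 * n) →
          i = j) ↔
      ∀ i : ZMod n, 0 < t i → ∀ d : ℕ, 0 < d → 0 < t (i + (d : ZMod n)) →
        (∀ e : ℕ, 0 < e → e < d → t (i + (e : ZMod n)) = 0) →
          2 ∣ (d - 1) := by
  have hblack : ∀ i, 0 < t i → 0 < t (i + (t i : ZMod n)) := by
    intro i hi
    by_contra h
    have h0 : t (i + (t i : ZMod n)) = 0 := by omega
    have h1 : i + (t i : ZMod n) = i := hvalid.1 (by simp [h0])
    rw [h1] at h0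
    omega
  have key := arcs_disjoint n t hsum hblack
  have hwhite : ∀ i, ∀ e : ℕ, 0 < e → e < t i → t (i + (e : ZMod n)) = 0 := by
    intro i e he hlt
    by_contra h
    have := (key i (i + (e : ZMod n)) e 0 hlt (by omega) (by simp)).2
    omega
  -- reduction of congruences modulo `2 * n` to equations in `ZMod n`
  have hcong : ∀ (i j : ZMod n) (a b : ℕ),
      (2 * i.val + (2 * a + 1)) % (2 * n) = (2 * j.val + (2 * b + 1)) % (2 * n) ∨
      (2 * i.val + (2 * a + 2)) % (2 * n) = (2 * j.val + (2 * b + 2)) % (2 * n) →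
      i + (a : ZMod n) = j + (b : ZMod n) := by
    intro i j a b h
    have h2 : 2 * (i.val + a) ≡ 2 * (j.val + b) [MOD 2 * n] := by
      rcases h with h | h
      · apply Nat.ModEq.add_right_cancel' 1
        show _ % _ = _ % _
        convert h using 2 <;> ring
      · apply Nat.ModEq.add_right_cancel' 2
        show _ % _ = _ % _
        convert h using 2 <;> ring
    have h3 : i.val + a ≡ j.val + b [MOD n] := Nat.ModEq.mul_left_cancel' (by norm_num) h2
    have h4 := (ZMod.natCast_eq_natCast_iff _ _ _).2 h3
    simpa using h4
  have hpar : ∀ x y : ℕ, x % (2 * n) = y % (2 * n) → x % 2 = y % 2 := by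
    intro x y h
    exact Nat.ModEq.of_mul_right n (h : x ≡ y [MOD 2 * n])
  constructor
  · rintro ⟨-, hs⟩ i hi d hd hbd hz
    have h1 : t i = d := by
      rcases lt_trichotomy (t i) d with h | h | h
      · have := hz _ hi h
        have := hblack i hi
        omega
      · exact h
      · have := hwhite i d hd h
        omega
    by_contra hodd
    obtain ⟨a, ha⟩ : ∃ a, t i = 2 * a := ⟨t i / 2, by omega⟩
    have hj : t (i + (a : ZMod n)) = 0 := hwhite i a (by omega) (by omega)
    have hv : (i + (a : ZMod n)).val ≡ i.val + a [MOD n] := by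
      rw [← ZMod.natCast_eq_natCast_iff]
      simp
    have hv2 : 2 * (i + (a : ZMod n)).val + 1 ≡ 2 * (i.val + a) + 1 [MOD 2 * n] :=
      (Nat.ModEq.mul_left' 2 hv).add_right 1
    have heq : i = i + (a : ZMod n) := by
      apply hs i _ (by omega) (by omega)
      rw [hj, ha]
      have := hv2.symm
      unfold Nat.ModEq at this
      convert this using 2
      ring
    have := (key i i 0 a hi (by omega) (by simpa using heq)).2
    omega
  · intro h
    have hodd : ∀ i, 0 < t i → 2 ∣ t i - 1 := fun i hi =>
      h i hi (t i) hi (hblack i hi) (fun e he hlt => hwhite i e he hlt)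
    constructor
    · have hc := (Equiv.addRight (1 : ZMod n)).bijective.comp hvalid
      convert hc using 1
      funext i
      simp [add_assoc]
    · intro i j _ _ hij
      have hp := hpar _ _ hij
      rcases Nat.eq_zero_or_pos (t i) with hi | hi <;>
        rcases Nat.eq_zero_or_pos (t j) with hj | hj
      · have := hcong i j 0 0 (Or.inl (by simpa [hi, hj] using hij))
        simpa using this
      · have := hodd j hj
        omega
      · have := hodd i hi
        omega
      · obtain ⟨a, ha⟩ := hodd i hi
        obtain ⟨b, hb⟩ := hodd j hj
        have ha' : t i + 1 = 2 * a + 2 := by omega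
        have hb' : t j + 1 = 2 * b + 2 := by omega
        rw [ha', hb'] at hij
        exact (key i j a b (by omega) (by omega) (hcong i j a b (Or.inr hij))).1
end
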